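/- Let α ∈ (0,1] and ζ ∈ [−π, π]. Then the real part of (1 − e^{−iζ})^α is nonnegative, where the power is the principal complex power (with 0^α = 0). -/

import Mathlib

/-- For `|α| ≤ 1`, the principal power `z ^ α` of a complex number in the closed right half-plane
stays in the closed right half-plane. -/
theorem Complex.cpow_ofReal_re_nonneg {z : ℂ} (hz : 0 ≤ z.re) {α : ℝ} (hα : |α| ≤ 1) :
    0 ≤ (z ^ (α : ℂ)).re := by
  rw [Complex.cpow_ofReal_re]
  have harg : |z.arg * α| ≤ Real.pi / 2 := by
    rw [abs_mul]
    exact (mul_le_of_le_one_right (abs_nonneg _) hα).trans (Complex.abs_arg_le_pi_div_two_iff.2 hz)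
  exact mul_nonneg (Real.rpow_nonneg (norm_nonneg z) α)
    (Real.cos_nonneg_of_mem_Icc (abs_le.1 harg))

/-- Symbol positivity of the backward Euler convolution quadrature: the real part of
`(1 - e^{-iζ})^α` is nonnegative for `α ∈ (0,1]` and `ζ ∈ [-π, π]`. -/
theorem cq_symbol_positivity (α : ℝ) (hα : α ∈ Set.Ioc (0 : ℝ) 1)
    (ζ : ℝ) (hζ : ζ ∈ Set.Icc (-Real.pi) Real.pi) :
    0 ≤ ((1 - Complex.exp (-(Complex.I * (ζ : ℂ)))) ^ (α : ℂ)).re := by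
  refine Complex.cpow_ofReal_re_nonneg ?_ ((abs_of_pos hα.1).trans_le hα.2)
  simp [Complex.exp_re, Real.cos_le_one]
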